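/- arXiv:2511.07629 — 4 statements merged into one kernel-verified Lean document; each statement's English description precedes it below -/
import Mathlib

section
/- Let n ≥ 1, let π₁,…,πₙ and μ₁,…,μₙ be per-agent policies, let S ⊆ {1,…,n}, and let d^{(S)} and d^{(∅)} be the discounted occupancy measures of the mixed policies π^{(S)} and π^{(∅)} = ∏ⱼ μⱼ (with respect to a common transition model P, discount γ ∈ (0,1), and initial distribution d₀). Then (1/2)·∑_{s∈𝒮} |d^{(S)}(s) − d^{(∅)}(s)| ≤ (γ/(1−γ)) · ∑_{i∈S} TV(πᵢ, μᵢ). -/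
theorem sum_abs_prod_sub_le : ∀ {n : ℕ} (A : Fin n → Type*) [∀ i, Fintype (A i)]
    (p q : ∀ i : Fin n, A i → ℝ)
    (_ : ∀ i b, 0 ≤ p i b) (_ : ∀ i, ∑ b, p i b = 1)
    (_ : ∀ i b, 0 ≤ q i b) (_ : ∀ i, ∑ b, q i b = 1),
    ∑ a : ∀ i, A i, |∏ i, p i (a i) - ∏ i, q i (a i)| ≤ ∑ i, ∑ b, |p i b - q i b| := by
  intro n
  induction n with
  | zero => intro A _ p q _ _ _ _; simp
  | succ n ih =>
    intro A _ p q hp0 hp1 hq0 hq1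
    have ih' := ih (fun i => A i.succ) (fun i => p i.succ) (fun i => q i.succ)
      (fun i => hp0 _) (fun i => hp1 _) (fun i => hq0 _) (fun i => hq1 _)
    rw [← (Fin.consEquiv A).sum_comp, Fintype.sum_prod_type, Fin.sum_univ_succ]
    simp only [Fin.consEquiv_apply, Fin.prod_univ_succ, Fin.cons_zero, Fin.cons_succ]
    have hP : ∑ a : (∀ i : Fin n, A i.succ), ∏ i, p i.succ (a i) = 1 := by
      rw [← Fintype.prod_sum]
      simp [hp1]
    calc ∑ x, ∑ a : (∀ i : Fin n, A i.succ),
          |p 0 x * ∏ i, p i.succ (a i) - q 0 x * ∏ i, q i.succ (a i)|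
        ≤ ∑ x, ∑ a : (∀ i : Fin n, A i.succ), (|p 0 x - q 0 x| * ∏ i, p i.succ (a i)
            + q 0 x * |∏ i, p i.succ (a i) - ∏ i, q i.succ (a i)|) := by
          refine Finset.sum_le_sum fun x _ => Finset.sum_le_sum fun a _ => ?_
          have h1 : 0 ≤ ∏ i, p i.succ (a i) := Finset.prod_nonneg fun i _ => hp0 _ _
          calc _ = |(p 0 x - q 0 x) * ∏ i, p i.succ (a i)
                + q 0 x * (∏ i, p i.succ (a i) - ∏ i, q i.succ (a i))| := by congr 1; ring
            _ ≤ _ := abs_add_le _ _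
            _ = _ := by rw [abs_mul, abs_mul, abs_of_nonneg h1, abs_of_nonneg (hq0 0 x)]
      _ = ∑ x, |p 0 x - q 0 x| + ∑ a : (∀ i : Fin n, A i.succ),
            |∏ i, p i.succ (a i) - ∏ i, q i.succ (a i)| := by
          simp only [Finset.sum_add_distrib, ← Finset.mul_sum, hP, mul_one]
          rw [← Finset.sum_mul, hq1, one_mul]
      _ ≤ _ := by gcongr

/-- Linear Divergence Bound: for a factorized behavior policy μ and a
subset S of agents, the total variation between the discounted occupancy measure of
the mixed policy π^{(S)} and that of μ is at most (γ/(1-γ))·∑_{i∈S} TV(πᵢ, μᵢ). -/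
theorem linear_divergence_bound
    {σ : Type*} [Fintype σ] [Nonempty σ]
    {n : ℕ} (hn : 1 ≤ n)
    (A : Fin n → Type*) [∀ i, Fintype (A i)]
    (π μ : ∀ i : Fin n, σ → A i → ℝ)
    (hπ0 : ∀ i s b, 0 ≤ π i s b) (hπ1 : ∀ i s, ∑ b, π i s b = 1)
    (hμ0 : ∀ i s b, 0 ≤ μ i s b) (hμ1 : ∀ i s, ∑ b, μ i s b = 1)
    (S : Finset (Fin n))
    (P : σ → (∀ i, A i) → σ → ℝ)
    (hP0 : ∀ s a s', 0 ≤ P s a s') (hP1 : ∀ s a, ∑ s', P s a s' = 1)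
    (γ : ℝ) (hγ0 : 0 < γ) (hγ1 : γ < 1)
    (d0 : σ → ℝ) (hd00 : ∀ s, 0 ≤ d0 s) (hd01 : ∑ s, d0 s = 1)
    (dS dE : σ → ℝ)
    (hdS0 : ∀ s, 0 ≤ dS s) (hdS1 : ∑ s, dS s = 1)
    (hdE0 : ∀ s, 0 ≤ dE s) (hdE1 : ∑ s, dE s = 1)
    -- dS is the discounted occupancy measure of the mixed policy π^{(S)}
    (hdS : ∀ s', dS s' = (1 - γ) * d0 s' +
      γ * ∑ s, dS s * ∑ a : ∀ i, A i,
        (∏ i, if i ∈ S then π i s (a i) else μ i s (a i)) * P s a s')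
    -- dE is the discounted occupancy measure of the behavior policy π^{(∅)} = ∏ μⱼ
    (hdE : ∀ s', dE s' = (1 - γ) * d0 s' +
      γ * ∑ s, dE s * ∑ a : ∀ i, A i, (∏ i, μ i s (a i)) * P s a s') :
    (1/2) * ∑ s, |dS s - dE s| ≤
      (γ / (1 - γ)) * ∑ i ∈ S, ⨆ s : σ, (1/2) * ∑ b, |π i s b - μ i s b| := by
  classical
  have hsum : ∀ s, ∑ a : ∀ i, A i, ∏ i, μ i s (a i) = 1 := by
    intro s
    rw [← Fintype.prod_sum]
    simp [hμ1]
  set T := ∑ i ∈ S, ⨆ s : σ, (1/2) * ∑ b, |π i s b - μ i s b| with hT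
  set D := ∑ s, |dS s - dE s| with hD
  set KE : σ → σ → ℝ := fun s s' => ∑ a : ∀ i, A i, (∏ i, μ i s (a i)) * P s a s' with hKE
  set KS : σ → σ → ℝ := fun s s' => ∑ a : ∀ i, A i,
    (∏ i, if i ∈ S then π i s (a i) else μ i s (a i)) * P s a s' with hKS
  have hKE0 : ∀ s s', 0 ≤ KE s s' := fun s s' => Finset.sum_nonneg fun a _ =>
    mul_nonneg (Finset.prod_nonneg fun i _ => hμ0 _ _ _) (hP0 _ _ _)
  have hKE1 : ∀ s, ∑ s', KE s s' = 1 := by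
    intro s
    simp only [hKE]
    rw [Finset.sum_comm]
    simp only [← Finset.mul_sum, hP1, mul_one, hsum]
  have hK : ∀ s, ∑ s', |KS s s' - KE s s'| ≤ 2 * T := by
    intro s
    have h1 := sum_abs_prod_sub_le A (fun i b => if i ∈ S then π i s b else μ i s b)
      (fun i => μ i s)
      (by intro i b; split_ifs; exacts [hπ0 _ _ _, hμ0 _ _ _])
      (by intro i; by_cases h : i ∈ S <;> simp [h, hπ1, hμ1])
      (fun i => hμ0 i s) (fun i => hμ1 i s)
    calc ∑ s', |KS s s' - KE s s'|
        ≤ ∑ s', ∑ a : ∀ i, A i, |(∏ i, if i ∈ S then π i s (a i) else μ i s (a i))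
            - ∏ i, μ i s (a i)| * P s a s' := by
          refine Finset.sum_le_sum fun s' _ => ?_
          simp only [hKS, hKE]
          rw [← Finset.sum_sub_distrib]
          refine (Finset.abs_sum_le_sum_abs _ _).trans (Finset.sum_le_sum fun a _ => ?_)
          rw [← sub_mul, abs_mul, abs_of_nonneg (hP0 s a s')]
      _ = ∑ a : ∀ i, A i, |(∏ i, if i ∈ S then π i s (a i) else μ i s (a i))
            - ∏ i, μ i s (a i)| := by
          rw [Finset.sum_comm]
          simp only [← Finset.mul_sum, hP1, mul_one]
      _ ≤ _ := h1
      _ = ∑ i ∈ S, ∑ b, |π i s b - μ i s b| := by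
          rw [← Finset.sum_subset (Finset.subset_univ S)]
          · refine Finset.sum_congr rfl fun i hi => ?_
            simp [hi]
          · intro i _ hi
            simp [hi]
      _ ≤ 2 * T := by
          rw [hT, Finset.mul_sum]
          refine Finset.sum_le_sum fun i _ => ?_
          have := le_ciSup (f := fun s : σ => (1/2) * ∑ b, |π i s b - μ i s b|)
            (Set.finite_range _).bddAbove s
          linarith
  have hmain : D ≤ γ * (D + 2 * T) := by
    calc D ≤ ∑ s', γ * (∑ s, |dS s - dE s| * KE s s' + ∑ s, dS s * |KS s s' - KE s s'|) := by
          refine Finset.sum_le_sum fun s' _ => ?_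
          have e : dS s' - dE s' = γ * (∑ s, (dS s - dE s) * KE s s'
              + ∑ s, dS s * (KS s s' - KE s s')) := by
            rw [hdS s', hdE s', add_sub_add_left_eq_sub, ← mul_sub, ← Finset.sum_sub_distrib,
              ← Finset.sum_add_distrib]
            congr 1
            refine Finset.sum_congr rfl fun s _ => ?_
            simp only [hKS, hKE]
            ring
          rw [e, abs_mul, abs_of_pos hγ0]
          refine mul_le_mul_of_nonneg_left ((abs_add_le _ _).trans (add_le_add ?_ ?_)) hγ0.le
          · refine (Finset.abs_sum_le_sum_abs _ _).trans (Finset.sum_le_sum fun s _ => ?_)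
            rw [abs_mul, abs_of_nonneg (hKE0 s s')]
          · refine (Finset.abs_sum_le_sum_abs _ _).trans (Finset.sum_le_sum fun s _ => ?_)
            rw [abs_mul, abs_of_nonneg (hdS0 s)]
      _ = γ * (D + ∑ s, dS s * ∑ s', |KS s s' - KE s s'|) := by
          rw [← Finset.mul_sum, Finset.sum_add_distrib, Finset.sum_comm,
            Finset.sum_comm (f := fun s' s => dS s * |KS s s' - KE s s'|)]
          simp only [← Finset.mul_sum, hKE1, mul_one, hD]
      _ ≤ γ * (D + 2 * T) := by
          refine mul_le_mul_of_nonneg_left (add_le_add le_rfl ?_) hγ0.le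
          calc _ ≤ ∑ s, dS s * (2 * T) :=
                Finset.sum_le_sum fun s _ => mul_le_mul_of_nonneg_left (hK s) (hdS0 s)
            _ = _ := by rw [← Finset.sum_mul, hdS1, one_mul]
  have h1 : 0 < 1 - γ := by linarith
  rw [div_mul_eq_mul_div γ, le_div_iff₀ h1]
  linarith
end

section
/- Let μ be a (possibly correlated) joint behavior policy with per-state marginals μᵢ(aᵢ|s) = ∑_{a_{-i}} μ(aᵢ, a_{-i}|s), and let κ = sup_{s∈𝒮} (1/2)·∑_{a∈𝒜} |μ(a|s) − ∏ᵢ μᵢ(aᵢ|s)| be the maximal excess correlation. Let π₁,…,πₙ be per-agent policies, S ⊆ {1,…,n}, and let d^{(S)} and d^μ be the discounted occupancy measures of the mixed policy π^{(S)} (built from πᵢ for i ∈ S and the marginals μⱼ for j ∉ S) and of μ, respectively. Then (1/2)·∑_{s∈𝒮} |d^{(S)}(s) − d^μ(s)| ≤ (γ/(1−γ)) · ( ∑_{i∈S} TV(πᵢ, μᵢ) + κ ). -/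
theorem aux_sum_prod {n : ℕ} (A : Fin n → Type*) [∀ i, Fintype (A i)] (h : ∀ i, A i → ℝ) :
    ∑ a : ∀ i, A i, ∏ i, h i (a i) = ∏ i, ∑ b, h i b := by
  classical
  rw [Finset.prod_univ_sum, Fintype.piFinset_univ]

theorem aux_prod_tv {n : ℕ} (A : Fin n → Type*) [∀ i, Fintype (A i)]
    (f g : ∀ i, A i → ℝ) (hf0 : ∀ i b, 0 ≤ f i b) (hg0 : ∀ i b, 0 ≤ g i b)
    (hf1 : ∀ i, ∑ b, f i b = 1) (hg1 : ∀ i, ∑ b, g i b = 1) (S : Finset (Fin n)) :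
    ∑ a : ∀ i, A i, |(∏ i, if i ∈ S then f i (a i) else g i (a i)) - ∏ i, g i (a i)|
      ≤ ∑ i ∈ S, ∑ b, |f i b - g i b| := by
  induction S using Finset.induction_on with
  | empty => simp
  | insert j T hj ih =>
    rw [Finset.sum_insert hj]
    have key : ∑ a : ∀ i, A i, |(∏ i, if i ∈ insert j T then f i (a i) else g i (a i))
        - ∏ i, if i ∈ T then f i (a i) else g i (a i)| = ∑ b, |f j b - g j b| := by
      have h1 : ∀ a : ∀ i, A i, |(∏ i, if i ∈ insert j T then f i (a i) else g i (a i))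
        - ∏ i, if i ∈ T then f i (a i) else g i (a i)| =
        ∏ i, (fun i b => if i = j then |f i b - g i b| else
          if i ∈ T then f i b else g i b) i (a i) := by
        intro a
        rw [← Finset.mul_prod_erase _ _ (Finset.mem_univ j),
          ← Finset.mul_prod_erase (a := j) _ (fun i => if i ∈ T then f i (a i) else g i (a i))
            (Finset.mem_univ j),
          ← Finset.mul_prod_erase (a := j) _ (fun i => (fun i b => if i = j then
            |f i b - g i b| else if i ∈ T then f i b else g i b) i (a i)) (Finset.mem_univ j)]
        have e1 : (∏ i ∈ Finset.univ.erase j, if i ∈ insert j T then f i (a i) else g i (a i))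
            = ∏ i ∈ Finset.univ.erase j, if i ∈ T then f i (a i) else g i (a i) := by
          refine Finset.prod_congr rfl fun i hi => ?_
          simp [Finset.ne_of_mem_erase hi]
        have e2 : (∏ i ∈ Finset.univ.erase j, (fun i b => if i = j then
            |f i b - g i b| else if i ∈ T then f i b else g i b) i (a i))
            = ∏ i ∈ Finset.univ.erase j, if i ∈ T then f i (a i) else g i (a i) := by
          refine Finset.prod_congr rfl fun i hi => ?_
          simp [Finset.ne_of_mem_erase hi]
        have e3 : 0 ≤ ∏ i ∈ Finset.univ.erase j, if i ∈ T then f i (a i) else g i (a i) := by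
          refine Finset.prod_nonneg fun i _ => ?_
          split_ifs
          · exact hf0 _ _
          · exact hg0 _ _
        rw [e1, e2, ← sub_mul, abs_mul, abs_of_nonneg e3]
        simp [hj]
      rw [Finset.sum_congr rfl fun a _ => h1 a, aux_sum_prod A (fun i b => if i = j then
          |f i b - g i b| else if i ∈ T then f i b else g i b),
        ← Finset.mul_prod_erase _ _ (Finset.mem_univ j)]
      rw [Finset.prod_eq_one]
      · simp
      · intro i hi
        have := Finset.ne_of_mem_erase hi
        by_cases hT : i ∈ T <;> simp [this, hT, hf1, hg1]
    rw [← key]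
    refine le_trans ?_ (add_le_add_right ih _)
    rw [← Finset.sum_add_distrib]
    exact Finset.sum_le_sum fun a _ => abs_sub_le _ _ _

theorem aux_occ {σ α : Type*} [Fintype σ] [Fintype α] (q μ : σ → α → ℝ)
    (hμ0 : ∀ s a, 0 ≤ μ s a) (hμ1 : ∀ s, ∑ a, μ s a = 1)
    (P : σ → α → σ → ℝ)
    (hP0 : ∀ s a s', 0 ≤ P s a s') (hP1 : ∀ s a, ∑ s', P s a s' = 1)
    (γ : ℝ) (hγ0 : 0 < γ) (hγ1 : γ < 1) (d0 dS dμ : σ → ℝ)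
    (hdS0 : ∀ s, 0 ≤ dS s) (hdS1 : ∑ s, dS s = 1)
    (hdS : ∀ s', dS s' = (1 - γ) * d0 s' + γ * ∑ s, dS s * ∑ a, q s a * P s a s')
    (hdμ : ∀ s', dμ s' = (1 - γ) * d0 s' + γ * ∑ s, dμ s * ∑ a, μ s a * P s a s')
    (C : ℝ) (hC : ∀ s, ∑ a, |q s a - μ s a| ≤ 2 * C) :
    (1/2) * ∑ s, |dS s - dμ s| ≤ (γ / (1 - γ)) * C := by
  have h1 : ∀ s', |dS s' - dμ s'| ≤
      γ * ∑ s, ∑ a, (dS s * |q s a - μ s a| + |dS s - dμ s| * μ s a) * P s a s' := by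
    intro s'
    have : dS s' - dμ s' = γ * ∑ s, ∑ a,
        (dS s * (q s a - μ s a) + (dS s - dμ s) * μ s a) * P s a s' := by
      rw [hdS s', hdμ s', add_sub_add_left_eq_sub, ← mul_sub, ← Finset.sum_sub_distrib]
      congr 1
      refine Finset.sum_congr rfl fun s _ => ?_
      rw [Finset.mul_sum, Finset.mul_sum, ← Finset.sum_sub_distrib]
      refine Finset.sum_congr rfl fun a _ => ?_
      ring
    rw [this, abs_mul, abs_of_pos hγ0]
    refine mul_le_mul_of_nonneg_left ?_ hγ0.le
    refine (Finset.abs_sum_le_sum_abs _ _).trans (Finset.sum_le_sum fun s _ => ?_)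
    refine (Finset.abs_sum_le_sum_abs _ _).trans (Finset.sum_le_sum fun a _ => ?_)
    rw [abs_mul, abs_of_nonneg (hP0 s a s')]
    refine mul_le_mul_of_nonneg_right ?_ (hP0 s a s')
    refine (abs_add_le _ _).trans (le_of_eq ?_)
    rw [abs_mul, abs_mul, abs_of_nonneg (hdS0 s), abs_of_nonneg (hμ0 s a)]
  have h2 : ∑ s, |dS s - dμ s| ≤ γ * (2 * C + ∑ s, |dS s - dμ s|) := by
    refine (Finset.sum_le_sum fun s' _ => h1 s').trans ?_
    rw [← Finset.mul_sum]
    refine mul_le_mul_of_nonneg_left ?_ hγ0.le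
    rw [Finset.sum_comm]
    have h3 : ∀ s, ∑ s', ∑ a, (dS s * |q s a - μ s a| + |dS s - dμ s| * μ s a) * P s a s'
        ≤ dS s * (2 * C) + |dS s - dμ s| := by
      intro s
      rw [Finset.sum_comm]
      simp_rw [← Finset.mul_sum, hP1, mul_one]
      rw [Finset.sum_add_distrib, ← Finset.mul_sum, ← Finset.mul_sum, hμ1, mul_one]
      exact add_le_add_left (mul_le_mul_of_nonneg_left (hC s) (hdS0 s)) _
    refine (Finset.sum_le_sum fun s _ => h3 s).trans (le_of_eq ?_)
    rw [Finset.sum_add_distrib, ← Finset.sum_mul, hdS1, one_mul]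
  rw [div_mul_eq_mul_div γ, le_div_iff₀ (by linarith)]
  nlinarith

/-- Linear Divergence with Correlations: for a possibly correlated
joint behavior policy μ with per-state marginals μᵢ and maximal excess correlation κ,
the total variation between the occupancy measure of the mixed policy π^{(S)} and
that of μ is at most (γ/(1-γ))·(∑_{i∈S} TV(πᵢ, μᵢ) + κ). -/
theorem linear_divergence_with_correlations
    {σ : Type*} [Fintype σ] [Nonempty σ]
    {n : ℕ} (hn : 1 ≤ n)
    (A : Fin n → Type*) [∀ i, Fintype (A i)] [∀ i, DecidableEq (A i)]
    (μ : σ → (∀ i, A i) → ℝ)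
    (hμ0 : ∀ s a, 0 ≤ μ s a) (hμ1 : ∀ s, ∑ a, μ s a = 1)
    (π : ∀ i : Fin n, σ → A i → ℝ)
    (hπ0 : ∀ i s b, 0 ≤ π i s b) (hπ1 : ∀ i s, ∑ b, π i s b = 1)
    -- per-state marginals of μ
    (μm : ∀ i : Fin n, σ → A i → ℝ)
    (hμm : ∀ i s b, μm i s b = ∑ a : ∀ j, A j, if a i = b then μ s a else 0)
    -- maximal excess correlation
    (κ : ℝ)
    (hκ : κ = ⨆ s : σ, (1/2) * ∑ a : ∀ i, A i, |μ s a - ∏ i, μm i s (a i)|)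
    (S : Finset (Fin n))
    (P : σ → (∀ i, A i) → σ → ℝ)
    (hP0 : ∀ s a s', 0 ≤ P s a s') (hP1 : ∀ s a, ∑ s', P s a s' = 1)
    (γ : ℝ) (hγ0 : 0 < γ) (hγ1 : γ < 1)
    (d0 : σ → ℝ) (hd00 : ∀ s, 0 ≤ d0 s) (hd01 : ∑ s, d0 s = 1)
    (dS dμ : σ → ℝ)
    (hdS0 : ∀ s, 0 ≤ dS s) (hdS1 : ∑ s, dS s = 1)
    (hdμ0 : ∀ s, 0 ≤ dμ s) (hdμ1 : ∑ s, dμ s = 1)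
    -- dS is the discounted occupancy measure of the mixed policy π^{(S)}
    (hdS : ∀ s', dS s' = (1 - γ) * d0 s' +
      γ * ∑ s, dS s * ∑ a : ∀ i, A i,
        (∏ i, if i ∈ S then π i s (a i) else μm i s (a i)) * P s a s')
    -- dμ is the discounted occupancy measure of the joint behavior policy μ
    (hdμ : ∀ s', dμ s' = (1 - γ) * d0 s' +
      γ * ∑ s, dμ s * ∑ a : ∀ i, A i, μ s a * P s a s') :
    (1/2) * ∑ s, |dS s - dμ s| ≤
      (γ / (1 - γ)) *
        ((∑ i ∈ S, ⨆ s : σ, (1/2) * ∑ b, |π i s b - μm i s b|) + κ) := by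
  have hm0 : ∀ i s b, 0 ≤ μm i s b := by
    intro i s b
    rw [hμm]
    refine Finset.sum_nonneg fun a _ => ?_
    split_ifs
    · exact hμ0 s a
    · exact le_rfl
  have hm1 : ∀ i s, ∑ b, μm i s b = 1 := by
    intro i s
    simp_rw [hμm]
    rw [Finset.sum_comm]
    simp [hμ1]
  refine aux_occ (fun s (a : ∀ i, A i) => ∏ i, if i ∈ S then π i s (a i) else μm i s (a i)) μ
    hμ0 hμ1 P hP0 hP1 γ hγ0 hγ1 d0 dS dμ hdS0 hdS1 hdS hdμ _ ?_
  intro s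
  have hk : (1/2) * ∑ a : ∀ i, A i, |μ s a - ∏ i, μm i s (a i)| ≤ κ := by
    rw [hκ]
    exact le_ciSup (f := fun s => (1/2) * ∑ a : ∀ i, A i, |μ s a - ∏ i, μm i s (a i)|)
      (Set.finite_range _).bddAbove s
  have ht : ∑ i ∈ S, (1/2) * ∑ b, |π i s b - μm i s b| ≤
      ∑ i ∈ S, ⨆ s : σ, (1/2) * ∑ b, |π i s b - μm i s b| :=
    Finset.sum_le_sum fun i _ =>
      le_ciSup (f := fun s => (1/2) * ∑ b, |π i s b - μm i s b|)
        (Set.finite_range _).bddAbove s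
  rw [← Finset.mul_sum] at ht
  have hp := aux_prod_tv A (fun i => π i s) (fun i => μm i s) (fun i => hπ0 i s)
    (fun i => hm0 i s) (fun i => hπ1 i s) (fun i => hm1 i s) S
  have htri : ∑ a : ∀ i, A i, |(∏ i, if i ∈ S then π i s (a i) else μm i s (a i)) - μ s a| ≤
      ∑ a : ∀ i, A i, |(∏ i, if i ∈ S then π i s (a i) else μm i s (a i)) - ∏ i, μm i s (a i)|
      + ∑ a : ∀ i, A i, |μ s a - ∏ i, μm i s (a i)| := by
    rw [← Finset.sum_add_distrib]
    refine Finset.sum_le_sum fun a _ => ?_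
    rw [abs_sub_comm (μ s a)]
    exact abs_sub_le _ _ _
  refine htri.trans ?_
  linarith
end

section
/- Let μ = ∏ⱼ μⱼ be a factorized joint behavior policy, π₁,…,πₙ per-agent learned policies, and w₁,…,wₙ ≥ 0 with ∑ₖ wₖ = 1. Define the soft-partial mixture policy π^{SP}(a|s) = ∑_{k=1}^{n} wₖ · (1/\binom{n}{k}) · ∑_{S ⊆ {1,…,n}, |S| = k} π^{(S)}(a|s), the effective number of deviating agents k_eff = ∑_{k=1}^{n} wₖ·k, and the average single-agent deviation \overline{TV}(π,μ) = (1/n)·∑_{i=1}^{n} TV(πᵢ, μᵢ). Let d^{SP} and d^μ be the discounted occupancy measures of π^{SP} and μ. Then (1/2)·∑_{s∈𝒮} |d^{SP}(s) − d^μ(s)| ≤ (γ/(1−γ)) · k_eff · \overline{TV}(π,μ). -/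
theorem spd_prod {ι : Type*} [Fintype ι] [DecidableEq ι] (A : ι → Type*) [∀ i, Fintype (A i)]
    (p q : ∀ i, A i → ℝ) (hp0 : ∀ i b, 0 ≤ p i b) (hp1 : ∀ i, ∑ b, p i b = 1)
    (hq0 : ∀ i b, 0 ≤ q i b) (hq1 : ∀ i, ∑ b, q i b = 1) (S : Finset ι) :
    ∑ a : ∀ i, A i, |(∏ i, if i ∈ S then p i (a i) else q i (a i)) - ∏ i, q i (a i)|
      ≤ ∑ i ∈ S, ∑ b, |p i b - q i b| := by
  induction S using Finset.induction_on with
  | empty => simp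
  | insert j T hj ih =>
    rw [Finset.sum_insert hj]
    let g : ∀ i, A i → ℝ := fun i b => if i = j then |p i b - q i b| else
      if i ∈ T then p i b else q i b
    have hg : ∑ a : ∀ i, A i, ∏ i, g i (a i) = ∑ b, |p j b - q j b| := by
      have := Finset.prod_univ_sum (fun i : ι => (Finset.univ : Finset (A i))) g
      rw [Fintype.piFinset_univ] at this
      rw [← this, Finset.prod_eq_single j]
      · simp [g]
      · intro i _ hi
        by_cases h : i ∈ T <;> simp [g, hi, h, hp1, hq1]
      · simp
    rw [← hg]
    refine le_trans ?_ (add_le_add_right ih _)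
    rw [← Finset.sum_add_distrib]
    refine Finset.sum_le_sum fun a _ => ?_
    have h1 : |(∏ i, if i ∈ insert j T then p i (a i) else q i (a i)) -
        ∏ i, if i ∈ T then p i (a i) else q i (a i)| = ∏ i, g i (a i) := by
      rw [← Finset.mul_prod_erase _ _ (Finset.mem_univ j),
        ← Finset.mul_prod_erase _ (fun i => if i ∈ T then p i (a i) else q i (a i)) (Finset.mem_univ j),
        ← Finset.mul_prod_erase _ (fun i => g i (a i)) (Finset.mem_univ j)]
      have e1 : ∏ i ∈ Finset.univ.erase j, (if i ∈ insert j T then p i (a i) else q i (a i))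
          = ∏ i ∈ Finset.univ.erase j, g i (a i) :=
        Finset.prod_congr rfl fun i hi => by
          have := Finset.ne_of_mem_erase hi
          simp [g, this]
      have e2 : ∏ i ∈ Finset.univ.erase j, (if i ∈ T then p i (a i) else q i (a i))
          = ∏ i ∈ Finset.univ.erase j, g i (a i) :=
        Finset.prod_congr rfl fun i hi => by
          have := Finset.ne_of_mem_erase hi
          simp [g, this]
      have e3 : 0 ≤ ∏ i ∈ Finset.univ.erase j, g i (a i) :=
        Finset.prod_nonneg fun i _ => by
          simp only [g]; split_ifs
          · exact abs_nonneg _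
          · exact hp0 _ _
          · exact hq0 _ _
      rw [e1, e2, ← sub_mul, abs_mul, abs_of_nonneg e3]
      simp [g, hj]
    rw [← h1]
    exact abs_sub_le _ _ _

theorem spd_count {n k : ℕ} (hk : 1 ≤ k) (hkn : k ≤ n) (t : Fin n → ℝ) :
    ((n.choose k : ℝ))⁻¹ * ∑ S ∈ Finset.powersetCard k (Finset.univ : Finset (Fin n)), ∑ i ∈ S, t i
      = k * ((1 / n : ℝ) * ∑ i, t i) := by
  have hc : ∀ i : Fin n, ((Finset.powersetCard k (Finset.univ : Finset (Fin n))).filter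
      (fun S => i ∈ S)).card = (n-1).choose (k-1) := by
    intro i
    have : ((Finset.powersetCard k (Finset.univ : Finset (Fin n))).filter
      (fun S => i ∈ S)) = (Finset.powersetCard (k-1) (Finset.univ.erase i)).image (insert i) := by
      ext S
      simp only [Finset.mem_filter, Finset.mem_powersetCard, Finset.mem_image, Finset.subset_univ, true_and]
      constructor
      · rintro ⟨h1, h2⟩
        exact ⟨S.erase i, ⟨Finset.erase_subset_erase _ (Finset.subset_univ _), by
          rw [Finset.card_erase_of_mem h2, h1]⟩, Finset.insert_erase h2⟩
      · rintro ⟨T, ⟨h1, h2⟩, rfl⟩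
        have : i ∉ T := fun h => by simpa using h1 h
        rw [Finset.card_insert_of_notMem this]
        exact ⟨by omega, Finset.mem_insert_self _ _⟩
    rw [this, Finset.card_image_of_injOn]
    · simp
    · intro S hS T hT h
      have hS' : i ∉ S := fun h => by simpa using (Finset.mem_powersetCard.1 hS).1 h
      have hT' : i ∉ T := fun h => by simpa using (Finset.mem_powersetCard.1 hT).1 h
      have h : insert i S = insert i T := h
      rw [← Finset.erase_insert hS', h, Finset.erase_insert hT']
  have h1 : ∑ S ∈ Finset.powersetCard k (Finset.univ : Finset (Fin n)), ∑ i ∈ S, t i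
      = ((n-1).choose (k-1) : ℝ) * ∑ i, t i := by
    have : ∀ S : Finset (Fin n), ∑ i ∈ S, t i = ∑ i, if i ∈ S then t i else 0 := by
      intro S; simp
    simp_rw [this]
    rw [Finset.sum_comm, Finset.mul_sum]
    refine Finset.sum_congr rfl fun i _ => ?_
    rw [← Finset.sum_filter, Finset.sum_const, hc, nsmul_eq_mul]
    simp
  rw [h1]
  obtain ⟨m, rfl⟩ : ∃ m, n = m + 1 := ⟨n-1, by omega⟩
  obtain ⟨l, rfl⟩ : ∃ l, k = l + 1 := ⟨k-1, by omega⟩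
  have h2 := Nat.add_one_mul_choose_eq m l
  have h3 : 0 < (m+1).choose (l+1) := Nat.choose_pos hkn
  have h2' : ((m:ℝ)+1) * (m.choose l) = ((m+1).choose (l+1) : ℝ) * ((l:ℝ)+1) := by exact_mod_cast h2
  have h3' : (0:ℝ) < ((m+1).choose (l+1) : ℝ) := by exact_mod_cast h3
  simp only [Nat.add_sub_cancel]
  push_cast
  field_simp
  linear_combination (∑ i, t i) * h2'

theorem spd_occ {σ B : Type*} [Fintype σ] [Fintype B] (f m : σ → B → ℝ)
    (hm0 : ∀ s a, 0 ≤ m s a) (hm1 : ∀ s, ∑ a, m s a = 1)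
    (P : σ → B → σ → ℝ)
    (hP0 : ∀ s a s', 0 ≤ P s a s') (hP1 : ∀ s a, ∑ s', P s a s' = 1)
    (γ : ℝ) (hγ0 : 0 < γ) (hγ1 : γ < 1) (d0 d e : σ → ℝ)
    (hd0 : ∀ s, 0 ≤ d s) (hd1 : ∑ s, d s = 1) (C : ℝ) (hC : ∀ s, ∑ a, |f s a - m s a| ≤ C)
    (hd : ∀ s', d s' = (1 - γ) * d0 s' + γ * ∑ s, d s * ∑ a, f s a * P s a s')
    (he : ∀ s', e s' = (1 - γ) * d0 s' + γ * ∑ s, e s * ∑ a, m s a * P s a s') :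
    ∑ s, |d s - e s| ≤ γ / (1 - γ) * C := by
  have key : ∀ s', |d s' - e s'| ≤ γ * ∑ s, ∑ a,
      (d s * |f s a - m s a| + |d s - e s| * m s a) * P s a s' := by
    intro s'
    have : d s' - e s' = γ * ∑ s, ∑ a,
      (d s * (f s a - m s a) + (d s - e s) * m s a) * P s a s' := by
      rw [hd s', he s', add_sub_add_left_eq_sub, ← mul_sub, ← Finset.sum_sub_distrib]
      congr 1
      refine Finset.sum_congr rfl fun s _ => ?_
      rw [Finset.mul_sum, Finset.mul_sum, ← Finset.sum_sub_distrib]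
      refine Finset.sum_congr rfl fun a _ => ?_
      ring
    rw [this, abs_mul, abs_of_pos hγ0]
    refine mul_le_mul_of_nonneg_left ?_ hγ0.le
    refine (Finset.abs_sum_le_sum_abs _ _).trans (Finset.sum_le_sum fun s _ => ?_)
    refine (Finset.abs_sum_le_sum_abs _ _).trans (Finset.sum_le_sum fun a _ => ?_)
    rw [abs_mul, abs_of_nonneg (hP0 s a s')]
    refine mul_le_mul_of_nonneg_right ?_ (hP0 _ _ _)
    refine (abs_add_le _ _).trans (le_of_eq ?_)
    rw [abs_mul, abs_mul, abs_of_nonneg (hd0 s), abs_of_nonneg (hm0 s a)]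
  have h2 : ∑ s, |d s - e s| ≤ γ * (C + ∑ s, |d s - e s|) := by
    refine (Finset.sum_le_sum fun s' _ => key s').trans ?_
    rw [← Finset.mul_sum]
    refine mul_le_mul_of_nonneg_left ?_ hγ0.le
    rw [Finset.sum_comm]
    have : ∀ s, ∑ s', ∑ a, (d s * |f s a - m s a| + |d s - e s| * m s a) * P s a s'
        = d s * ∑ a, |f s a - m s a| + |d s - e s| := by
      intro s
      rw [Finset.sum_comm]
      simp_rw [← Finset.mul_sum, hP1, mul_one]
      rw [Finset.sum_add_distrib, ← Finset.mul_sum, ← Finset.mul_sum, hm1, mul_one]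
    simp_rw [this]
    rw [Finset.sum_add_distrib]
    refine add_le_add_left ?_ _
    calc _ ≤ ∑ s, d s * C := Finset.sum_le_sum fun s _ => mul_le_mul_of_nonneg_left (hC s) (hd0 s)
      _ = C := by rw [← Finset.sum_mul, hd1, one_mul]
  rw [div_mul_eq_mul_div, le_div_iff₀ (by linarith)]
  linarith


/-- Soft-partial divergence bound: the total variation between the
discounted occupancy measure of the soft-partial mixture policy π^{SP} and that of
the factorized behavior policy μ is at most (γ/(1-γ))·k_eff·\overline{TV}(π,μ). -/
theorem soft_partial_divergence_bound
    {σ : Type*} [Fintype σ] [Nonempty σ]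
    {n : ℕ} (hn : 1 ≤ n)
    (A : Fin n → Type*) [∀ i, Fintype (A i)]
    (π μ : ∀ i : Fin n, σ → A i → ℝ)
    (hπ0 : ∀ i s b, 0 ≤ π i s b) (hπ1 : ∀ i s, ∑ b, π i s b = 1)
    (hμ0 : ∀ i s b, 0 ≤ μ i s b) (hμ1 : ∀ i s, ∑ b, μ i s b = 1)
    (w : ℕ → ℝ)
    (hw0 : ∀ k ∈ Finset.Icc 1 n, 0 ≤ w k)
    (hw1 : ∑ k ∈ Finset.Icc 1 n, w k = 1)
    (P : σ → (∀ i, A i) → σ → ℝ)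
    (hP0 : ∀ s a s', 0 ≤ P s a s') (hP1 : ∀ s a, ∑ s', P s a s' = 1)
    (γ : ℝ) (hγ0 : 0 < γ) (hγ1 : γ < 1)
    (d0 : σ → ℝ) (hd00 : ∀ s, 0 ≤ d0 s) (hd01 : ∑ s, d0 s = 1)
    (dSP dμ : σ → ℝ)
    (hdSP0 : ∀ s, 0 ≤ dSP s) (hdSP1 : ∑ s, dSP s = 1)
    (hdμ0 : ∀ s, 0 ≤ dμ s) (hdμ1 : ∑ s, dμ s = 1)
    -- dSP is the discounted occupancy measure of the soft-partial mixture policy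
    -- π^{SP}(a|s) = ∑_{k=1}^n wₖ · (1/C(n,k)) · ∑_{|S|=k} π^{(S)}(a|s)
    (hdSP : ∀ s', dSP s' = (1 - γ) * d0 s' +
      γ * ∑ s, dSP s * ∑ a : ∀ i, A i,
        (∑ k ∈ Finset.Icc 1 n, w k * ((n.choose k : ℝ))⁻¹ *
          ∑ S ∈ Finset.powersetCard k (Finset.univ : Finset (Fin n)),
            ∏ i, if i ∈ S then π i s (a i) else μ i s (a i)) * P s a s')
    -- dμ is the discounted occupancy measure of the behavior policy μ = ∏ μⱼ
    (hdμ : ∀ s', dμ s' = (1 - γ) * d0 s' +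
      γ * ∑ s, dμ s * ∑ a : ∀ i, A i, (∏ i, μ i s (a i)) * P s a s') :
    (1/2) * ∑ s, |dSP s - dμ s| ≤
      (γ / (1 - γ)) * (∑ k ∈ Finset.Icc 1 n, w k * k) *
        ((1 / n : ℝ) * ∑ i, ⨆ s : σ, (1/2) * ∑ b, |π i s b - μ i s b|) := by
  set t : Fin n → ℝ := fun i => ⨆ s : σ, (1/2) * ∑ b, |π i s b - μ i s b| with ht
  have htle : ∀ i s, ∑ b, |π i s b - μ i s b| ≤ 2 * t i := by
    intro i s
    have := le_ciSup (f := fun s : σ => (1/2 : ℝ) * ∑ b, |π i s b - μ i s b|)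
      (Set.finite_range _).bddAbove s
    simp only [ht]
    linarith
  have hcard : ∀ k ∈ Finset.Icc 1 n, ((n.choose k : ℝ))⁻¹ * (n.choose k : ℝ) = 1 := by
    intro k hk
    have : 0 < n.choose k := Nat.choose_pos (Finset.mem_Icc.1 hk).2
    have : (0:ℝ) < n.choose k := by exact_mod_cast this
    field_simp
  have main := spd_occ
    (fun s a => ∑ k ∈ Finset.Icc 1 n, w k * ((n.choose k : ℝ))⁻¹ *
          ∑ S ∈ Finset.powersetCard k (Finset.univ : Finset (Fin n)),
            ∏ i, if i ∈ S then π i s (a i) else μ i s (a i))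
    (fun s (a : ∀ i, A i) => ∏ i, μ i s (a i))
    (fun s a => Finset.prod_nonneg fun i _ => hμ0 _ _ _)
    (fun s => by
      have := Finset.prod_univ_sum (fun i : Fin n => (Finset.univ : Finset (A i))) (fun i => μ i s)
      rw [Fintype.piFinset_univ] at this
      rw [← this]
      simp [hμ1])
    P hP0 hP1 γ hγ0 hγ1 d0 dSP dμ hdSP0 hdSP1
    (2 * ((∑ k ∈ Finset.Icc 1 n, w k * k) * ((1 / n : ℝ) * ∑ i, t i))) ?_ hdSP hdμ
  · calc (1/2) * ∑ s, |dSP s - dμ s| ≤ (1/2) * (γ / (1 - γ) *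
          (2 * ((∑ k ∈ Finset.Icc 1 n, w k * k) * ((1 / n : ℝ) * ∑ i, t i)))) := by
          linarith
      _ = _ := by ring
  · intro s
    have h1 : ∀ a : ∀ i, A i, |(∑ k ∈ Finset.Icc 1 n, w k * ((n.choose k : ℝ))⁻¹ *
          ∑ S ∈ Finset.powersetCard k (Finset.univ : Finset (Fin n)),
            ∏ i, if i ∈ S then π i s (a i) else μ i s (a i)) - ∏ i, μ i s (a i)|
        ≤ ∑ k ∈ Finset.Icc 1 n, w k * ((n.choose k : ℝ))⁻¹ *
          ∑ S ∈ Finset.powersetCard k (Finset.univ : Finset (Fin n)),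
            |(∏ i, if i ∈ S then π i s (a i) else μ i s (a i)) - ∏ i, μ i s (a i)| := by
      intro a
      have e : (∑ k ∈ Finset.Icc 1 n, w k * ((n.choose k : ℝ))⁻¹ *
          ∑ S ∈ Finset.powersetCard k (Finset.univ : Finset (Fin n)),
            ∏ i, if i ∈ S then π i s (a i) else μ i s (a i)) - ∏ i, μ i s (a i)
          = ∑ k ∈ Finset.Icc 1 n, w k * ((n.choose k : ℝ))⁻¹ *
          ∑ S ∈ Finset.powersetCard k (Finset.univ : Finset (Fin n)),
            ((∏ i, if i ∈ S then π i s (a i) else μ i s (a i)) - ∏ i, μ i s (a i)) := by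
        have e' : ∏ i, μ i s (a i) = ∑ k ∈ Finset.Icc 1 n, w k * ∏ i, μ i s (a i) := by
          rw [← Finset.sum_mul, hw1, one_mul]
        refine (congrArg (fun x => _ - x) e').trans ?_
        rw [← Finset.sum_sub_distrib]
        refine Finset.sum_congr rfl fun k hk => ?_
        rw [Finset.sum_sub_distrib, Finset.sum_const, Finset.card_powersetCard,
          Finset.card_univ, Fintype.card_fin, nsmul_eq_mul]
        linear_combination (w k * ∏ i, μ i s (a i)) * hcard k hk
      rw [e]
      refine (Finset.abs_sum_le_sum_abs _ _).trans (Finset.sum_le_sum fun k hk => ?_)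
      have h0 : 0 ≤ w k * ((n.choose k : ℝ))⁻¹ := mul_nonneg (hw0 k hk) (by positivity)
      rw [abs_mul, abs_of_nonneg h0]
      exact mul_le_mul_of_nonneg_left (Finset.abs_sum_le_sum_abs _ _) h0
    refine (Finset.sum_le_sum fun a _ => h1 a).trans ?_
    rw [Finset.sum_comm, Finset.sum_mul, Finset.mul_sum]
    refine Finset.sum_le_sum fun k hk => ?_
    rw [← Finset.mul_sum, Finset.sum_comm]
    have h0 : 0 ≤ w k * ((n.choose k : ℝ))⁻¹ := mul_nonneg (hw0 k hk) (by positivity)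
    have h2 : ∑ S ∈ Finset.powersetCard k (Finset.univ : Finset (Fin n)), ∑ a : ∀ i, A i,
        |(∏ i, if i ∈ S then π i s (a i) else μ i s (a i)) - ∏ i, μ i s (a i)|
        ≤ ∑ S ∈ Finset.powersetCard k (Finset.univ : Finset (Fin n)), ∑ i ∈ S, 2 * t i :=
      Finset.sum_le_sum fun S _ =>
        (spd_prod A (fun i => π i s) (fun i => μ i s) (fun i => hπ0 i s) (fun i => hπ1 i s)
          (fun i => hμ0 i s) (fun i => hμ1 i s) S).trans
          (Finset.sum_le_sum fun i _ => htle i s)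
    refine (mul_le_mul_of_nonneg_left h2 h0).trans (le_of_eq ?_)
    rw [mul_assoc, spd_count (Finset.mem_Icc.1 hk).1 (Finset.mem_Icc.1 hk).2, ← Finset.mul_sum]
    ring
end

section
/- Let 𝒮 be a finite type, γ ∈ (0,1), d₀ a probability mass function on 𝒮, and P, P' row-stochastic kernels on 𝒮. Suppose d and d' are probability mass functions on 𝒮 satisfying the occupancy fixed-point equations d(s') = (1−γ)d₀(s') + γ·∑_s d(s)P(s'|s) and d'(s') = (1−γ)d₀(s') + γ·∑_s d'(s)P'(s'|s) for all s'. Then ∑_{s'} |d(s') − d'(s')| ≤ (γ/(1−γ)) · ∑_{s'} | ∑_s d(s)·(P(s'|s) − P'(s'|s)) |. -/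
/-- the ℓ¹ distance between the discounted occupancy measures of two
kernels is bounded by γ/(1-γ) times the ℓ¹ norm of the occupancy-weighted kernel
difference. -/
theorem occupancy_l1_difference_bound
    {σ : Type*} [Fintype σ]
    (γ : ℝ) (hγ0 : 0 < γ) (hγ1 : γ < 1)
    (d0 : σ → ℝ) (hd00 : ∀ s, 0 ≤ d0 s) (hd01 : ∑ s, d0 s = 1)
    (P P' : σ → σ → ℝ)
    (hP0 : ∀ s s', 0 ≤ P s s') (hP1 : ∀ s, ∑ s', P s s' = 1)
    (hP'0 : ∀ s s', 0 ≤ P' s s') (hP'1 : ∀ s, ∑ s', P' s s' = 1)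
    (d d' : σ → ℝ)
    (hd0 : ∀ s, 0 ≤ d s) (hd1 : ∑ s, d s = 1)
    (hd'0 : ∀ s, 0 ≤ d' s) (hd'1 : ∑ s, d' s = 1)
    (hd : ∀ s', d s' = (1 - γ) * d0 s' + γ * ∑ s, d s * P s s')
    (hd' : ∀ s', d' s' = (1 - γ) * d0 s' + γ * ∑ s, d' s * P' s s') :
    ∑ s', |d s' - d' s'| ≤
      (γ / (1 - γ)) * ∑ s', |∑ s, d s * (P s s' - P' s s')| := by
  have h1 : ∀ s', |d s' - d' s'| ≤
      γ * |∑ s, d s * (P s s' - P' s s')| + γ * ∑ s, |d s - d' s| * P' s s' := by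
    intro s'
    have e : d s' - d' s' = γ * ∑ s, d s * (P s s' - P' s s')
        + γ * ∑ s, (d s - d' s) * P' s s' := by
      rw [hd s', hd' s']
      simp only [mul_sub, sub_mul, Finset.sum_sub_distrib]
      ring
    have h2 : |∑ s, (d s - d' s) * P' s s'| ≤ ∑ s, |d s - d' s| * P' s s' := by
      refine (Finset.abs_sum_le_sum_abs _ _).trans (le_of_eq ?_)
      refine Finset.sum_congr rfl fun s _ => ?_
      rw [abs_mul, abs_of_nonneg (hP'0 s s')]
    rw [e]
    refine (abs_add_le _ _).trans ?_
    rw [abs_mul, abs_mul, abs_of_pos hγ0]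
    exact add_le_add le_rfl (mul_le_mul_of_nonneg_left h2 hγ0.le)
  have h3 := Finset.sum_le_sum fun s' (_ : s' ∈ Finset.univ) => h1 s'
  have h4 : ∑ s', ∑ s, |d s - d' s| * P' s s' = ∑ s, |d s - d' s| := by
    rw [Finset.sum_comm]
    refine Finset.sum_congr rfl fun s _ => ?_
    rw [← Finset.mul_sum, hP'1, mul_one]
  rw [Finset.sum_add_distrib, ← Finset.mul_sum, ← Finset.mul_sum, h4] at h3
  have hg : 0 < 1 - γ := by linarith
  rw [div_mul_eq_mul_div, le_div_iff₀ hg]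
  linarith
end
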